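/- Let G be a subcubic graph with a list assignment L with |L(e)| ≥ 10 for all edges, such that G is not strongly L-edge-colorable but every proper subgraph is. Then G contains no cycle of length 5. -/

import Mathlib

def StrongSees {V : Type*} (G : SimpleGraph V) (e e' : Sym2 V) : Prop :=
  (∃ v, v ∈ e ∧ v ∈ e') ∨ (∃ u v, u ∈ e ∧ v ∈ e' ∧ G.Adj u v)

def IsStrongEdgeColoring {V β : Type*} (G : SimpleGraph V) (c : Sym2 V → β) : Prop :=
  ∀ e ∈ G.edgeSet, ∀ e' ∈ G.edgeSet, e ≠ e' → StrongSees G e e' → c e ≠ c e'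

def StronglyListColorable {V β : Type*} (G : SimpleGraph V) (L : Sym2 V → Finset β) : Prop :=
  ∃ c : Sym2 V → β, IsStrongEdgeColoring G c ∧ ∀ e ∈ G.edgeSet, c e ∈ L e


namespace FC

open MvPolynomial

def dig (k i : ℕ) : ℕ := k / 8 ^ i % 8

/-- evaluate the numeral `n` before passing it on -/
noncomputable def frc {α : Type} (n : ℕ) (f : ℕ → α) : α :=
  Nat.rec (motive := fun _ => α) (f 0) (fun n _ => f (Nat.succ n)) n

theorem frc_eq {α : Type} (n : ℕ) (f : ℕ → α) : frc n f = f n := by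
  cases n <;> rfl

noncomputable def mrg (l : List (ℕ × ℕ)) : List (ℕ × ℕ) → List (ℕ × ℕ) :=
  List.rec (motive := fun _ => List (ℕ × ℕ) → List (ℕ × ℕ)) (fun r => r)
    (fun x l ihl r =>
      List.rec (motive := fun _ => List (ℕ × ℕ)) (x :: l)
        (fun y r ihr =>
          Bool.rec (motive := fun _ => List (ℕ × ℕ))
            (Bool.rec (motive := fun _ => List (ℕ × ℕ)) (y :: ihr)
              (frc (Nat.add x.2 y.2) fun w => (x.1, w) :: ihl r) (Nat.beq x.1 y.1))
            (x :: ihl (y :: r)) (Nat.ble (Nat.succ x.1) y.1)) r) l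

def cnt (i : ℕ) : List (ℕ × ℕ) → ℕ
  | [] => 0
  | e :: es => (bif Nat.beq e.1 i then 1 else 0) + (bif Nat.beq e.2 i then 1 else 0) + cnt i es

/-- lower the exponent of variable `a`, scaling the weights by `s`; drop impossible monomials -/
noncomputable def low (pa pb ca cb s : ℕ) (l : List (ℕ × ℕ)) : List (ℕ × ℕ) :=
  List.rec (motive := fun _ => List (ℕ × ℕ)) []
    (fun x _ ih =>
      Bool.rec (motive := fun _ => List (ℕ × ℕ))
        (frc (Nat.sub x.1 pa) fun k =>
          Bool.rec (motive := fun _ => List (ℕ × ℕ)) ih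
            (Bool.rec (motive := fun _ => List (ℕ × ℕ)) ih
              (frc (Nat.mod (Nat.mul s x.2) 1024) fun w => (k, w) :: ih)
              (Nat.ble (Nat.mod (Nat.div k pb) 8) cb))
            (Nat.ble (Nat.mod (Nat.div k pa) 8) ca))
        ih
        (Nat.beq (Nat.mod (Nat.div x.1 pa) 8) 0)) l

noncomputable def run : List (ℕ × ℕ) → List (ℕ × ℕ) → Bool
  | [], [x] => Nat.beq x.1 0 && !(Nat.beq (Nat.mod x.2 1024) 0)
  | [], _ => false
  | e :: es, st =>
    frc (8 ^ e.1) fun pa => frc (8 ^ e.2) fun pb =>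
    frc (cnt e.1 es) fun ca => frc (cnt e.2 es) fun cb =>
    run es (mrg (low pa pb ca cb 1 st) (low pb pa cb ca 1023 st))

def es0 : List (ℕ × ℕ) :=
  [(6, 5), (7, 5), (8, 5), (9, 5), (5, 0), (5, 1), (5, 2), (5, 4), (7, 6), (8, 6), (9, 6), (6, 0),
   (6, 1), (6, 2), (6, 3), (8, 7), (9, 7), (7, 1), (7, 2), (7, 3), (7, 4), (9, 8), (8, 0), (8, 2),
   (8, 3), (8, 4), (9, 0), (9, 1), (9, 3), (9, 4), (0, 1), (4, 0), (1, 2), (2, 3), (3, 4)]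

def opt (b : Bool) (e : ℕ × ℕ) : List (ℕ × ℕ) := bif b then [e] else []

def esb (b0 b1 b2 b3 b4 : Bool) : List (ℕ × ℕ) :=
  es0 ++ (opt b0 (0, 2) ++ (opt b1 (1, 3) ++ (opt b2 (2, 4) ++ (opt b3 (3, 0) ++ opt b4 (4, 1)))))

def mask (b0 b1 b2 b3 b4 : Bool) : ℕ :=
  b0.toNat + 2 * b1.toNat + 4 * b2.toNat + 8 * b3.toNat + 16 * b4.toNat

def isRep (b0 b1 b2 b3 b4 : Bool) : Bool :=
  [0, 1, 3, 5, 7, 11, 15, 31].contains (mask b0 b1 b2 b3 b4)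

def tab : List ℕ := [750171667, 632719060, 766785308, 750176065, 628541763, 632719965, 632720092,
  765774189]

def tgt (b0 b1 b2 b3 b4 : Bool) : ℕ :=
  tab.getD ([0, 1, 3, 5, 7, 11, 15, 31].idxOf (mask b0 b1 b2 b3 b4)) 0

def capf (b0 b1 b2 b3 b4 : Bool) : List ℕ :=
  [4 + b0.toNat + b3.toNat, 4 + b1.toNat + b4.toNat, 4 + b2.toNat + b0.toNat,
   4 + b3.toNat + b1.toNat, 4 + b4.toNat + b2.toNat, 6, 6, 6, 6, 6]

theorem run_ok : ∀ b0 b1 b2 b3 b4 : Bool, isRep b0 b1 b2 b3 b4 = true →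
    frc (tgt b0 b1 b2 b3 b4) (fun t => run (esb b0 b1 b2 b3 b4) [(t, 1)]) = true := by
  decide +kernel

theorem cap_ok : ∀ b0 b1 b2 b3 b4 : Bool, isRep b0 b1 b2 b3 b4 = true → ∀ i : Fin 10,
    dig (tgt b0 b1 b2 b3 b4) i < (capf b0 b1 b2 b3 b4).getD i 0 := by
  decide +kernel

theorem deg_ok : ∀ b0 b1 b2 b3 b4 : Bool, isRep b0 b1 b2 b3 b4 = true →
    ((List.range 10).map (dig (tgt b0 b1 b2 b3 b4))).sum = (esb b0 b1 b2 b3 b4).length := by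
  decide +kernel

theorem es_lt : ∀ b0 b1 b2 b3 b4 : Bool, ∀ e ∈ esb b0 b1 b2 b3 b4, e.1 < 10 ∧ e.2 < 10 := by
  decide +kernel

noncomputable def dec (k : ℕ) : Fin 10 →₀ ℕ := Finsupp.equivFunOnFinite.symm fun i => dig k i

theorem dec_apply (k : ℕ) (i : Fin 10) : dec k i = dig k i := rfl

theorem dig_sub (k i j : ℕ) (h : k / 8 ^ i % 8 ≠ 0) :
    (k - 8 ^ i) / 8 ^ j % 8 = k / 8 ^ j % 8 - (if i = j then 1 else 0) := by
  have hq : (k - 8 ^ i) / 8 ^ i = k / 8 ^ i - 1 := by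
    have := Nat.sub_mul_div k (8 ^ i) 1
    simpa using this
  rcases lt_trichotomy i j with hij | rfl | hij
  · rw [if_neg hij.ne]
    obtain ⟨d, rfl⟩ := Nat.exists_eq_add_of_lt hij
    have e : 8 ^ (i + d + 1) = 8 ^ i * (8 * 8 ^ d) := by ring
    rw [e, ← Nat.div_div_eq_div_mul, ← Nat.div_div_eq_div_mul, hq, ← Nat.div_div_eq_div_mul,
      ← Nat.div_div_eq_div_mul]
    have : (k / 8 ^ i - 1) / 8 = k / 8 ^ i / 8 := by generalize k / 8 ^ i = q at h; omega
    rw [this]; simp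
  · rw [if_pos rfl, hq]; generalize k / 8 ^ i = q at h; omega
  · rw [if_neg hij.ne']
    obtain ⟨d, rfl⟩ := Nat.exists_eq_add_of_lt hij
    have e : 8 ^ (j + d + 1) = 8 ^ j * (8 * 8 ^ d) := by ring
    rw [e] at h ⊢
    rw [Nat.sub_mul_div]
    have h2 : 8 * 8 ^ d ≤ k / 8 ^ j := by
      by_contra hc
      apply h
      rw [← Nat.div_div_eq_div_mul, Nat.div_eq_of_lt (by omega)]
    generalize k / 8 ^ j = q at h2 ⊢; omega

theorem dec_sub (k : ℕ) (i : Fin 10) (h : dig k i ≠ 0) :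
    dec (k - 8 ^ (i : ℕ)) = dec k - Finsupp.single i 1 := by
  ext j
  rw [Finsupp.tsub_apply, dec_apply, dec_apply, Finsupp.single_apply]
  unfold dig at *
  rw [dig_sub k i j h]
  by_cases hij : i = j
  · simp [hij]
  · simp [hij, Fin.val_inj]

noncomputable def X' (i : ℕ) : MvPolynomial (Fin 10) ℤ := X (Fin.ofNat 10 i)

noncomputable def poly (es : List (ℕ × ℕ)) : MvPolynomial (Fin 10) ℤ :=
  (es.map fun e => X' e.1 - X' e.2).prod

theorem coeff_X'_mul (i : ℕ) (hi : i < 10) (k : ℕ) (p : MvPolynomial (Fin 10) ℤ) :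
    coeff (dec k) (X' i * p) = if 0 < dig k i then coeff (dec (k - 8 ^ i)) p else 0 := by
  unfold X'
  rw [coeff_X_mul']
  have hv : ((Fin.ofNat 10 i : Fin 10) : ℕ) = i := by simp [Fin.ofNat, Nat.mod_eq_of_lt hi]
  by_cases h : 0 < dig k i
  · rw [if_pos h, if_pos]
    · rw [← dec_sub k _ (by rw [hv]; omega), hv]
    · rw [Finsupp.mem_support_iff, dec_apply, hv]; omega
  · rw [if_neg h, if_neg]
    rw [Finsupp.mem_support_iff, dec_apply, hv]; omega

theorem coeff_zero_of_cnt (es : List (ℕ × ℕ)) (hes : ∀ e ∈ es, e.1 < 10 ∧ e.2 < 10)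
    (i : ℕ) (hi : i < 10) (m : Fin 10 →₀ ℕ) (h : cnt i es < m (Fin.ofNat 10 i)) :
    coeff m (poly es) = 0 := by
  induction es generalizing m with
  | nil =>
    simp only [poly, List.map_nil, List.prod_nil]
    rw [coeff_one, if_neg]
    rintro rfl
    simp at h
  | cons e es ih =>
    have h1 := hes e (by simp)
    have key : ∀ a < 10, (bif Nat.beq a i then 1 else 0) + cnt i es < m (Fin.ofNat 10 i) →
        coeff m (X' a * poly es) = 0 := by
      intro a ha hh
      unfold X'
      rw [coeff_X_mul']
      split_ifs with hs
      · apply ih (fun e he => hes e (by simp [he]))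
        rw [Finsupp.tsub_apply, Finsupp.single_apply]
        by_cases hai : a = i
        · subst hai
          have : Nat.beq a a = true := by simp
          rw [this] at hh
          simp only [cond_true] at hh
          rw [if_pos rfl]; omega
        · have h3 : (Fin.ofNat 10 a : Fin 10) ≠ Fin.ofNat 10 i := by
            intro h4
            apply hai
            have := congrArg Fin.val h4
            simpa [Fin.ofNat, Nat.mod_eq_of_lt hi, Nat.mod_eq_of_lt ha] using this
          rw [if_neg h3]
          omega
      · rfl
    have : poly (e :: es) = X' e.1 * poly es - X' e.2 * poly es := by
      simp [poly, sub_mul]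
    rw [this, coeff_sub]
    simp only [cnt] at h
    rw [key _ h1.1 (by omega), key _ h1.2 (by omega), sub_zero]

noncomputable def lam (es : List (ℕ × ℕ)) (st : List (ℕ × ℕ)) : ZMod 1024 :=
  (st.map fun x => (x.2 : ZMod 1024) * ((coeff (dec x.1) (poly es) : ℤ) : ZMod 1024)).sum

theorem lam_cons (es : List (ℕ × ℕ)) (x : ℕ × ℕ) (l : List (ℕ × ℕ)) : lam es (x :: l) =
    (x.2 : ZMod 1024) * ((coeff (dec x.1) (poly es) : ℤ) : ZMod 1024) + lam es l := by
  simp [lam]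

theorem mrg_cons (x y : ℕ × ℕ) (l r : List (ℕ × ℕ)) : mrg (x :: l) (y :: r) =
    Bool.rec (motive := fun _ => List (ℕ × ℕ))
      (Bool.rec (motive := fun _ => List (ℕ × ℕ)) (y :: mrg (x :: l) r)
        (frc (Nat.add x.2 y.2) fun w => (x.1, w) :: mrg l r) (Nat.beq x.1 y.1))
      (x :: mrg l (y :: r)) (Nat.ble (Nat.succ x.1) y.1) := rfl

theorem lam_mrg (es : List (ℕ × ℕ)) (l r : List (ℕ × ℕ)) :
    lam es (mrg l r) = lam es l + lam es r := by
  induction l generalizing r with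
  | nil =>
    have : mrg [] r = r := rfl
    simp [this, lam]
  | cons x l ihl =>
    induction r with
    | nil =>
      have : mrg (x :: l) [] = x :: l := rfl
      simp [this, lam]
    | cons y r ihr =>
      rw [mrg_cons]
      cases h1 : Nat.ble (Nat.succ x.1) y.1
      · cases h2 : Nat.beq x.1 y.1
        · simp only
          rw [lam_cons, ihr, lam_cons, lam_cons]; ring
        · simp only
          rw [frc_eq, lam_cons, ihl, lam_cons, lam_cons, ← Nat.eq_of_beq_eq_true h2]
          simp only [Nat.add_eq, Nat.cast_add]
          ring
      · simp only
        rw [lam_cons, ihl, lam_cons, lam_cons]; ring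

theorem low_cons (pa pb ca cb s : ℕ) (x : ℕ × ℕ) (l : List (ℕ × ℕ)) :
    low pa pb ca cb s (x :: l) =
      if x.1 / pa % 8 = 0 then low pa pb ca cb s l
      else if (x.1 - pa) / pa % 8 ≤ ca ∧ (x.1 - pa) / pb % 8 ≤ cb then
        (x.1 - pa, s * x.2 % 1024) :: low pa pb ca cb s l
      else low pa pb ca cb s l := by
  have : low pa pb ca cb s (x :: l) = Bool.rec (motive := fun _ => List (ℕ × ℕ))
        (frc (Nat.sub x.1 pa) fun k =>
          Bool.rec (motive := fun _ => List (ℕ × ℕ)) (low pa pb ca cb s l)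
            (Bool.rec (motive := fun _ => List (ℕ × ℕ)) (low pa pb ca cb s l)
              (frc (Nat.mod (Nat.mul s x.2) 1024) fun w => (k, w) :: (low pa pb ca cb s l))
              (Nat.ble (Nat.mod (Nat.div k pb) 8) cb))
            (Nat.ble (Nat.mod (Nat.div k pa) 8) ca))
        (low pa pb ca cb s l)
        (Nat.beq (Nat.mod (Nat.div x.1 pa) 8) 0) := rfl
  rw [this]
  simp only [frc_eq]
  have e1 : Nat.mod (Nat.div x.1 pa) 8 = x.1 / pa % 8 := rfl
  have e2 : Nat.mod (Nat.div (Nat.sub x.1 pa) pa) 8 = (x.1 - pa) / pa % 8 := rfl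
  have e3 : Nat.mod (Nat.div (Nat.sub x.1 pa) pb) 8 = (x.1 - pa) / pb % 8 := rfl
  rw [e1, e2, e3]
  cases h1 : Nat.beq (x.1 / pa % 8) 0
  · rw [if_neg (Nat.ne_of_beq_eq_false h1)]
    cases h2 : Nat.ble ((x.1 - pa) / pa % 8) ca
    · have : ¬ (x.1 - pa) / pa % 8 ≤ ca := fun h => by
        rw [Nat.ble_eq_true_of_le h] at h2; simp at h2
      simp [this]
    · cases h3 : Nat.ble ((x.1 - pa) / pb % 8) cb
      · have : ¬ (x.1 - pa) / pb % 8 ≤ cb := fun h => by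
          rw [Nat.ble_eq_true_of_le h] at h3; simp at h3
        simp [this]
      · rw [if_pos ⟨Nat.le_of_ble_eq_true h2, Nat.le_of_ble_eq_true h3⟩]
        rfl
  · rw [if_pos (Nat.eq_of_beq_eq_true h1)]

theorem lam_low (es : List (ℕ × ℕ)) (hes : ∀ e ∈ es, e.1 < 10 ∧ e.2 < 10) (a b : ℕ) (ha : a < 10)
    (hb : b < 10) (s : ℕ) (st : List (ℕ × ℕ)) :
    lam es (low (8 ^ a) (8 ^ b) (cnt a es) (cnt b es) s st) =
      s * (st.map fun x => (x.2 : ZMod 1024) *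
        ((coeff (dec x.1) (X' a * poly es) : ℤ) : ZMod 1024)).sum := by
  have hv : ∀ i < 10, ((Fin.ofNat 10 i : Fin 10) : ℕ) = i := by
    intro i hi; simp [Fin.ofNat, Nat.mod_eq_of_lt hi]
  induction st with
  | nil =>
    have : low (8 ^ a) (8 ^ b) (cnt a es) (cnt b es) s [] = [] := rfl
    simp [this, lam]
  | cons x l ih =>
    rw [low_cons, List.map_cons, List.sum_cons, coeff_X'_mul a ha, mul_add, ← ih]
    by_cases h : x.1 / 8 ^ a % 8 = 0
    · rw [if_pos h, if_neg (by unfold dig; omega)]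
      simp
    · have hd : 0 < dig x.1 a := by unfold dig; omega
      rw [if_neg h, if_pos hd]
      split_ifs with h2
      · rw [lam_cons]
        simp only [ZMod.natCast_mod, Nat.cast_mul]
        ring
      · have : coeff (dec (x.1 - 8 ^ a)) (poly es) = 0 := by
          rw [not_and_or] at h2
          rcases h2 with h2 | h2
          · apply coeff_zero_of_cnt es hes a ha
            rw [dec_apply, hv a ha]
            unfold dig; omega
          · apply coeff_zero_of_cnt es hes b hb
            rw [dec_apply, hv b hb]
            unfold dig; omega
        rw [this]; simp

theorem run_sound (es : List (ℕ × ℕ)) (hes : ∀ e ∈ es, e.1 < 10 ∧ e.2 < 10) (st : List (ℕ × ℕ))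
    (h : run es st = true) : lam es st ≠ 0 := by
  induction es generalizing st with
  | nil =>
    match st, h with
    | [x], h =>
      rw [run, Bool.and_eq_true] at h
      have h1 := Nat.eq_of_beq_eq_true h.1
      have h2 : x.2 % 1024 ≠ 0 := by
        have := h.2
        intro h3
        have h4 : Nat.mod x.2 1024 = 0 := h3
        rw [h4] at this
        simp at this
      have : dec 0 = 0 := by ext i; simp [dec_apply, dig]
      have h5 : (x.2 : ZMod 1024) ≠ 0 := by
        rw [ne_eq, ZMod.natCast_eq_zero_iff]
        omega
      simp [lam, poly, h1, this, h5]
  | cons e es ih =>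
    have h1 := hes e (by simp)
    have h2 : ∀ e ∈ es, e.1 < 10 ∧ e.2 < 10 := fun e he => hes e (by simp [he])
    rw [run] at h
    simp only [frc_eq] at h
    have := ih h2 _ h
    rw [lam_mrg, lam_low es h2 _ _ h1.1 h1.2, lam_low es h2 _ _ h1.2 h1.1] at this
    have hp : poly (e :: es) = X' e.1 * poly es - X' e.2 * poly es := by
      simp [poly, sub_mul]
    have hm : ((1023 : ℕ) : ZMod 1024) = -1 := by decide
    intro h0
    apply this
    rw [← h0, lam, hp, hm]
    clear this h h0
    induction st with
    | nil => simp
    | cons x l ih2 =>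
      simp only [List.map_cons, List.sum_cons, coeff_sub, Int.cast_sub] at ih2 ⊢
      rw [← ih2]
      push_cast
      ring

theorem totalDegree_poly (es : List (ℕ × ℕ)) : (poly es).totalDegree ≤ es.length := by
  induction es with
  | nil => simp [poly]
  | cons e es ih =>
    have hp : poly (e :: es) = (X' e.1 - X' e.2) * poly es := by simp [poly]
    rw [hp]
    refine (totalDegree_mul _ _).trans ?_
    have : (X' e.1 - X' e.2).totalDegree ≤ 1 := by
      refine (totalDegree_sub _ _).trans ?_
      simp [X', totalDegree_X]
    simp only [List.length_cons]
    omega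

theorem eval_poly (es : List (ℕ × ℕ)) (s : Fin 10 → ℤ) (h : eval s (poly es) ≠ 0) :
    ∀ e ∈ es, s (Fin.ofNat 10 e.1) ≠ s (Fin.ofNat 10 e.2) := by
  intro e he h0
  apply h
  rw [poly, map_list_prod]
  apply List.prod_eq_zero
  rw [List.map_map, List.mem_map]
  exact ⟨e, he, by simp only [X', Function.comp, map_sub, eval_X, h0, sub_self]⟩


theorem gen_int (es : List (ℕ × ℕ)) (hes : ∀ e ∈ es, e.1 < 10 ∧ e.2 < 10) (t : ℕ)
    (hr : run es [(t, 1)] = true) (hd : ((List.range 10).map (dig t)).sum = es.length)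
    (S : Fin 10 → Finset ℤ) (hS : ∀ i : Fin 10, dig t i < (S i).card) :
    ∃ s : Fin 10 → ℤ, (∀ i, s i ∈ S i) ∧ ∀ e ∈ es,
      s (Fin.ofNat 10 e.1) ≠ s (Fin.ofNat 10 e.2) := by
  have h1 := run_sound _ hes _ hr
  have h2 : coeff (dec t) (poly es) ≠ 0 := by
    intro h
    simp [lam, h] at h1
  have h3 : (dec t).degree = es.length := by
    rw [← hd, Finsupp.degree_eq_sum]
    simp [Fin.sum_univ_succ, dec_apply, List.range_succ]
  have h4 : (dec t).degree ≤ (poly es).totalDegree := by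
    have := le_totalDegree (mem_support_iff.2 h2)
    exact this
  obtain ⟨s, hs, he⟩ := combinatorial_nullstellensatz_exists_eval_nonzero _ _ h2
    (le_antisymm (h3 ▸ totalDegree_poly _) h4) S hS
  exact ⟨s, hs, eval_poly _ _ he⟩

theorem gen_col {β : Type*} (es : List (ℕ × ℕ)) (hes : ∀ e ∈ es, e.1 < 10 ∧ e.2 < 10) (t : ℕ)
    (hr : run es [(t, 1)] = true) (hd : ((List.range 10).map (dig t)).sum = es.length)
    (S : Fin 10 → Finset β) (hS : ∀ i : Fin 10, dig t i < (S i).card) :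
    ∃ s : Fin 10 → β, (∀ i, s i ∈ S i) ∧ ∀ e ∈ es,
      s (Fin.ofNat 10 e.1) ≠ s (Fin.ofNat 10 e.2) := by
  classical
  let U := Finset.univ.biUnion S
  let f : β → ℤ := fun x => if h : x ∈ U then ((U.equivFin ⟨x, h⟩ : Fin _) : ℕ) else 0
  have hf : Set.InjOn f U := by
    intro x hx y hy hxy
    have hx' : x ∈ U := hx
    have hy' : y ∈ U := hy
    simp only [f, dif_pos hx', dif_pos hy'] at hxy
    have := U.equivFin.injective (Fin.ext (by exact_mod_cast hxy))
    simpa using this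
  have hsub : ∀ i, S i ⊆ U := fun i => Finset.subset_biUnion_of_mem S (Finset.mem_univ i)
  obtain ⟨s, hs, he⟩ := gen_int es hes t hr hd (fun i => (S i).image f) (fun i => by
    rw [Finset.card_image_of_injOn (hf.mono (by exact_mod_cast hsub i))]
    exact hS i)
  have : ∀ i, ∃ x ∈ S i, f x = s i := fun i => Finset.mem_image.1 (hs i)
  choose u hu huf using this
  refine ⟨u, hu, fun e hh h0 => he e hh ?_⟩
  rw [← huf, ← huf, h0]

def Good (β : Type*) (b0 b1 b2 b3 b4 : Bool) : Prop :=
  ∀ S : Fin 10 → Finset β, (∀ i : Fin 10, (capf b0 b1 b2 b3 b4).getD i 0 ≤ (S i).card) →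
    ∃ s : Fin 10 → β, (∀ i, s i ∈ S i) ∧ ∀ e ∈ esb b0 b1 b2 b3 b4,
      s (Fin.ofNat 10 e.1) ≠ s (Fin.ofNat 10 e.2)

theorem good_rep (β : Type*) (b0 b1 b2 b3 b4 : Bool) (hb : isRep b0 b1 b2 b3 b4 = true) :
    Good β b0 b1 b2 b3 b4 := by
  intro S hS
  have h0 := run_ok b0 b1 b2 b3 b4 hb
  rw [frc_eq] at h0
  exact gen_col _ (es_lt b0 b1 b2 b3 b4) _ h0 (deg_ok _ _ _ _ _ hb) S
    (fun i => (cap_ok b0 b1 b2 b3 b4 hb i).trans_le (hS i))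

def rot (i : Fin 10) : Fin 10 :=
  ⟨[1, 2, 3, 4, 0, 6, 7, 8, 9, 5].getD i 0, by revert i; decide⟩

def unrot (i : Fin 10) : Fin 10 :=
  ⟨[4, 0, 1, 2, 3, 9, 5, 6, 7, 8].getD i 0, by revert i; decide⟩

theorem cap_rot : ∀ b0 b1 b2 b3 b4 : Bool, ∀ i : Fin 10,
    (capf b1 b2 b3 b4 b0).getD i 0 = (capf b0 b1 b2 b3 b4).getD (rot i) 0 := by
  decide +kernel

theorem mem_esb (b0 b1 b2 b3 b4 : Bool) (e : ℕ × ℕ) : e ∈ esb b0 b1 b2 b3 b4 ↔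
    e ∈ es0 ∨ (b0 = true ∧ e = (0, 2)) ∨ (b1 = true ∧ e = (1, 3)) ∨ (b2 = true ∧ e = (2, 4)) ∨
    (b3 = true ∧ e = (3, 0)) ∨ (b4 = true ∧ e = (4, 1)) := by
  have h : ∀ (b : Bool) (e' : ℕ × ℕ), e ∈ opt b e' ↔ b = true ∧ e = e' := by
    intro b e'
    cases b <;> simp [opt]
  rw [esb]
  simp only [List.mem_append, h]

theorem es0_rot : ∀ e ∈ es0,
    ((unrot (Fin.ofNat 10 e.1)).val, (unrot (Fin.ofNat 10 e.2)).val) ∈ es0 ∨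
    ((unrot (Fin.ofNat 10 e.2)).val, (unrot (Fin.ofNat 10 e.1)).val) ∈ es0 := by
  decide +kernel

theorem es_rot : ∀ b0 b1 b2 b3 b4 : Bool, ∀ e ∈ esb b0 b1 b2 b3 b4,
    ((unrot (Fin.ofNat 10 e.1)).val, (unrot (Fin.ofNat 10 e.2)).val) ∈ esb b1 b2 b3 b4 b0 ∨
    ((unrot (Fin.ofNat 10 e.2)).val, (unrot (Fin.ofNat 10 e.1)).val) ∈ esb b1 b2 b3 b4 b0 := by
  intro b0 b1 b2 b3 b4 e he
  rw [mem_esb] at he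
  simp only [mem_esb]
  rcases he with he | ⟨h, rfl⟩ | ⟨h, rfl⟩ | ⟨h, rfl⟩ | ⟨h, rfl⟩ | ⟨h, rfl⟩
  · rcases es0_rot e he with h | h
    · exact Or.inl (Or.inl h)
    · exact Or.inr (Or.inl h)
  all_goals simp only [h, true_and]
  · exact Or.inl (by right; right; right; right; right; rfl)
  · exact Or.inl (by right; left; rfl)
  · exact Or.inl (by right; right; left; rfl)
  · exact Or.inl (by right; right; right; left; rfl)
  · exact Or.inl (by right; right; right; right; left; rfl)

theorem good_rot (β : Type*) (b0 b1 b2 b3 b4 : Bool) (h : Good β b1 b2 b3 b4 b0) :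
    Good β b0 b1 b2 b3 b4 := by
  intro S hS
  obtain ⟨s, hs, he⟩ := h (fun i => S (rot i)) (fun i => by
    rw [cap_rot]; exact hS _)
  have hru : ∀ i, rot (unrot i) = i := by decide
  have hof : ∀ i : Fin 10, Fin.ofNat 10 (i : ℕ) = i := by decide
  refine ⟨fun i => s (unrot i), fun i => ?_, fun e hh => ?_⟩
  · have := hs (unrot i)
    rwa [hru] at this
  · rcases es_rot b0 b1 b2 b3 b4 e hh with h1 | h1
    · have := he _ h1
      simpa only [hof] using this
    · have := he _ h1
      simp only [hof] at this
      exact this.symm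

theorem rep_rot : ∀ b0 b1 b2 b3 b4 : Bool, isRep b0 b1 b2 b3 b4 = true ∨
    isRep b1 b2 b3 b4 b0 = true ∨ isRep b2 b3 b4 b0 b1 = true ∨ isRep b3 b4 b0 b1 b2 = true ∨
    isRep b4 b0 b1 b2 b3 = true := by
  decide +kernel

theorem good_all (β : Type*) (b0 b1 b2 b3 b4 : Bool) : Good β b0 b1 b2 b3 b4 := by
  rcases rep_rot b0 b1 b2 b3 b4 with h | h | h | h | h
  · exact good_rep _ _ _ _ _ _ h
  · exact good_rot _ _ _ _ _ _ (good_rep _ _ _ _ _ _ h)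
  · exact good_rot _ _ _ _ _ _ (good_rot _ _ _ _ _ _ (good_rep _ _ _ _ _ _ h))
  · exact good_rot _ _ _ _ _ _ (good_rot _ _ _ _ _ _ (good_rot _ _ _ _ _ _
      (good_rep _ _ _ _ _ _ h)))
  · exact good_rot _ _ _ _ _ _ (good_rot _ _ _ _ _ _ (good_rot _ _ _ _ _ _
      (good_rot _ _ _ _ _ _ (good_rep _ _ _ _ _ _ h))))

end FC


namespace FC

section graph

set_option linter.unusedSectionVars false

variable {V β : Type*} [Fintype V]

structure Ctx (G : SimpleGraph V) [DecidableRel G.Adj] (L : Sym2 V → Finset β) : Prop where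
  deg : ∀ v, G.degree v ≤ 3
  hL : ∀ e ∈ G.edgeSet, 10 ≤ (L e).card
  hG : ¬ StronglyListColorable G L
  hmin : ∀ H : SimpleGraph V, H ≤ G → H ≠ G → StronglyListColorable H L

theorem sees_symm {G : SimpleGraph V} {e e' : Sym2 V} (h : StrongSees G e e') :
    StrongSees G e' e := by
  rcases h with ⟨v, h1, h2⟩ | ⟨u, v, h1, h2, h3⟩
  · exact Or.inl ⟨v, h2, h1⟩
  · exact Or.inr ⟨v, u, h2, h1, h3.symm⟩

theorem sees_mk {G : SimpleGraph V} {x y z w : V} : StrongSees G s(x, y) s(z, w) ↔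
    (x = z ∨ x = w ∨ y = z ∨ y = w) ∨ (G.Adj x z ∨ G.Adj x w ∨ G.Adj y z ∨ G.Adj y w) := by
  unfold StrongSees
  simp only [Sym2.mem_iff]
  apply or_congr
  · constructor
    · rintro ⟨v, rfl | rfl, rfl | rfl⟩ <;> simp
    · rintro (rfl | rfl | rfl | rfl)
      · exact ⟨x, by simp⟩
      · exact ⟨x, by simp⟩
      · exact ⟨y, by simp⟩
      · exact ⟨y, by simp⟩
  · constructor
    · rintro ⟨u, v, rfl | rfl, rfl | rfl, h⟩ <;> simp [h]
    · rintro (h | h | h | h)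
      · exact ⟨x, z, by simp, by simp, h⟩
      · exact ⟨x, w, by simp, by simp, h⟩
      · exact ⟨y, z, by simp, by simp, h⟩
      · exact ⟨y, w, by simp, by simp, h⟩

open scoped Classical in
noncomputable def nb (G : SimpleGraph V) (e : Sym2 V) : Finset (Sym2 V) :=
  Finset.univ.filter fun y => y ∈ G.edgeSet ∧ y ≠ e ∧ StrongSees G e y

open scoped Classical in
theorem ext_false {G : SimpleGraph V} [DecidableRel G.Adj] {L : Sym2 V → Finset β} (C : Ctx G L)
    {k : ℕ} (g : Fin k → Sym2 V) (hinj : Function.Injective g) (hge : ∀ i, g i ∈ G.edgeSet)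
    (v w : V) (hvw : G.Adj v w) (hv : ∀ x, G.Adj v x → ∃ i, g i = s(v, x)) (m : Fin k → ℕ)
    (hm : ∀ i, (nb G (g i)).card ≤ m i)
    (hcol : ∀ F : Fin k → Finset β,
      (∀ i, 10 + (Finset.univ.filter fun j => j ≠ i ∧ StrongSees G (g i) (g j)).card
        ≤ (F i).card + m i) →
      ∃ φ : Fin k → β, (∀ i, φ i ∈ F i) ∧ ∀ i j, i ≠ j → StrongSees G (g i) (g j) → φ i ≠ φ j) :
    False := by
  let H : SimpleGraph V :=
    { Adj := fun x y => G.Adj x y ∧ x ≠ v ∧ y ≠ v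
      symm := ⟨fun x y h => ⟨h.1.symm, h.2.2, h.2.1⟩⟩
      loopless := ⟨fun x h => G.loopless.irrefl x h.1⟩ }
  have hHG : H ≤ G := fun x y h => h.1
  have hne : H ≠ G := by
    intro h
    have : H.Adj v w := by rw [h]; exact hvw
    exact this.2.1 rfl
  obtain ⟨c0, hc0, hcL⟩ := C.hmin H hHG hne
  let U : Finset (Sym2 V) := Finset.univ.image g
  obtain ⟨φ, hφ, hφc⟩ := hcol (fun i => L (g i) \ ((nb G (g i) \ U).image c0)) (fun i => by
    have h1 := C.hL _ (hge i)
    have h2 := Finset.le_card_sdiff ((nb G (g i) \ U).image c0) (L (g i))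
    have h3 : ((nb G (g i) \ U).image c0).card ≤ (nb G (g i) \ U).card := Finset.card_image_le
    have h4 := Finset.card_sdiff_add_card_inter (nb G (g i)) U
    have h5 : (Finset.univ.filter fun j => j ≠ i ∧ StrongSees G (g i) (g j)).card
        ≤ (nb G (g i) ∩ U).card := by
      apply Finset.card_le_card_of_injOn g
      · intro j hj
        simp only [Finset.coe_filter, Finset.mem_univ, true_and, Set.mem_ofPred_eq] at hj
        simp only [Finset.coe_inter, Set.mem_inter_iff, Finset.mem_coe]
        refine ⟨?_, Finset.mem_image_of_mem _ (Finset.mem_univ _)⟩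
        simp only [nb, Finset.mem_filter, Finset.mem_univ, true_and]
        exact ⟨hge j, fun h => hj.1 (hinj h), hj.2⟩
      · exact hinj.injOn
    have h6 := hm i
    omega)
  let c : Sym2 V → β := fun e => if h : ∃ i, g i = e then φ h.choose else c0 e
  have hcg : ∀ i, c (g i) = φ i := by
    intro i
    have h : ∃ j, g j = g i := ⟨i, rfl⟩
    simp only [c, dif_pos h]
    rw [hinj h.choose_spec]
  have hcn : ∀ e, (¬ ∃ i, g i = e) → c e = c0 e := by
    intro e h
    simp only [c, dif_neg h]
  have hve : ∀ e ∈ G.edgeSet, (¬ ∃ i, g i = e) → v ∉ e := by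
    intro e he h hve
    obtain ⟨x, rfl⟩ := Sym2.mem_iff_exists.1 hve
    exact h (hv x he)
  have hH : ∀ e ∈ G.edgeSet, (¬ ∃ i, g i = e) → e ∈ H.edgeSet := by
    intro e he h
    have := hve e he h
    induction e using Sym2.ind with
    | _ x y =>
      simp only [Sym2.mem_iff, not_or] at this
      exact ⟨he, fun h => this.1 h.symm, fun h => this.2 h.symm⟩
  have hmix : ∀ i, ∀ e ∈ G.edgeSet, (¬ ∃ i, g i = e) → StrongSees G (g i) e → φ i ≠ c0 e := by
    intro i e he h hs h0
    have h1 := (Finset.mem_sdiff.1 (hφ i)).2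
    apply h1
    rw [h0]
    apply Finset.mem_image_of_mem
    rw [Finset.mem_sdiff]
    constructor
    · simp only [nb, Finset.mem_filter, Finset.mem_univ, true_and]
      exact ⟨he, fun h' => h ⟨i, h'.symm⟩, hs⟩
    · intro h'
      obtain ⟨j, -, hj⟩ := Finset.mem_image.1 h'
      exact h ⟨j, hj⟩
  apply C.hG
  refine ⟨c, ?_, ?_⟩
  · intro e he e' he' hne hs
    by_cases h : ∃ i, g i = e
    · obtain ⟨i, rfl⟩ := h
      by_cases h' : ∃ i, g i = e'
      · obtain ⟨j, rfl⟩ := h'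
        rw [hcg, hcg]
        exact hφc i j (fun h => hne (by rw [h])) hs
      · rw [hcg, hcn _ h']
        exact hmix i e' he' h' hs
    · by_cases h' : ∃ i, g i = e'
      · obtain ⟨j, rfl⟩ := h'
        rw [hcg, hcn _ h]
        exact (hmix j e he h (sees_symm hs)).symm
      · rw [hcn _ h, hcn _ h']
        apply hc0 e (hH e he h) e' (hH e' he' h') hne
        rcases hs with hs | ⟨x, y, hx, hy, hxy⟩
        · exact Or.inl hs
        · refine Or.inr ⟨x, y, hx, hy, hxy, ?_, ?_⟩
          · rintro rfl; exact hve e he h hx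
          · rintro rfl; exact hve e' he' h' hy
  · intro e he
    by_cases h : ∃ i, g i = e
    · obtain ⟨i, rfl⟩ := h
      rw [hcg]
      exact (Finset.mem_sdiff.1 (hφ i)).1
    · rw [hcn _ h]
      exact hcL e (hH e he h)

/-- combinatorial conditions for a reducible configuration -/
def chc (k : ℕ) (es non : List (ℕ × ℕ)) (cap m : List ℕ) : Bool :=
  Nat.ble k 10 &&
  es.all (fun e => Nat.blt e.1 k && Nat.blt e.2 k) &&
  (List.range k).all (fun i => Nat.ble (cap.getD i 0 + m.getD i 0)
    (10 + ((List.range k).filter fun j => (!Nat.beq j i) &&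
      (es.contains (i, j) || es.contains (j, i))).length)) &&
  (List.range k).all (fun i => Nat.blt 0 (cap.getD i 0)) &&
  (List.range k).all (fun i => (List.range k).all fun j =>
    Nat.ble j i || es.contains (i, j) || es.contains (j, i) || non.contains (i, j))

open scoped Classical in
theorem red_core {G : SimpleGraph V} [DecidableRel G.Adj] {L : Sym2 V → Finset β} (C : Ctx G L)
    (k : ℕ) (gl : List (Sym2 V)) (hk : gl.length = k) (d : Sym2 V) (es non : List (ℕ × ℕ))
    (cap ml : List ℕ) (hchk : chc k es non cap ml = true)
    (hcl : ∀ S : Fin 10 → Finset β, (∀ i : Fin 10, (i : ℕ) < k → cap.getD i 0 ≤ (S i).card) →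
      (∀ i, (S i).Nonempty) → ∃ s : Fin 10 → β, (∀ i, s i ∈ S i) ∧ ∀ e ∈ es,
      s (Fin.ofNat 10 e.1) ≠ s (Fin.ofNat 10 e.2))
    (hnd : gl.Nodup) (hge : ∀ e ∈ gl, e ∈ G.edgeSet)
    (v w : V) (hvw : G.Adj v w) (hv : ∀ x, G.Adj v x → s(v, x) ∈ gl)
    (hm : ∀ p ∈ gl.zip ml, (nb G p.1).card ≤ p.2) (hml : ml.length = k)
    (hs : ∀ p ∈ es, StrongSees G (gl.getD p.1 d) (gl.getD p.2 d))
    (hns : ∀ p ∈ non, ¬ StrongSees G (gl.getD p.1 d) (gl.getD p.2 d)) : False := by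
  subst hk
  simp only [chc, Bool.and_eq_true, List.all_eq_true, List.mem_range, Bool.or_eq_true,
    List.contains_iff_mem, Nat.ble_eq, Nat.blt_eq, Nat.beq_eq] at hchk
  obtain ⟨⟨⟨⟨hk, hlt⟩, hcap⟩, hpos⟩, hnon⟩ := hchk
  have hgd : ∀ i : Fin gl.length, gl.getD i d = gl.get i := by
    intro i; simp
  refine ext_false C gl.get (List.nodup_iff_injective_get.1 hnd) (fun i => hge _ (List.get_mem _ _))
    v w hvw (fun x hx => List.get_of_mem (hv x hx)) (fun i => ml.getD i 0) (fun i => ?_) ?_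
  · have h1 : (gl.get i, ml.getD i 0) ∈ gl.zip ml := by
      rw [List.mem_iff_getElem]
      refine ⟨i, by simp [hml], ?_⟩
      have : (i : ℕ) < ml.length := by rw [hml]; exact i.2
      simp [this]
    exact hm _ h1
  · intro F hF
    have hiff : ∀ i j : Fin gl.length, i ≠ j → StrongSees G (gl.get i) (gl.get j) →
        ((i : ℕ), (j : ℕ)) ∈ es ∨ ((j : ℕ), (i : ℕ)) ∈ es := by
      intro i j hij hss
      rcases lt_or_gt_of_ne hij with h | h
      · rcases hnon i i.2 j j.2 with ((h1 | h1) | h1) | h1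
        · have : (i : ℕ) < j := h
          omega
        · exact Or.inl h1
        · exact Or.inr h1
        · have := hns _ h1
          simp only [hgd] at this
          exact absurd hss this
      · rcases hnon j j.2 i i.2 with ((h1 | h1) | h1) | h1
        · have : (j : ℕ) < i := h
          omega
        · exact Or.inr h1
        · exact Or.inl h1
        · have := hns _ h1
          simp only [hgd] at this
          exact absurd (sees_symm hss) this
    have hsz : ∀ i : Fin gl.length, cap.getD i 0 ≤ (F i).card := by
      intro i
      have h1 := hcap i i.2
      have h2 := hF i
      have h3 : ((List.range gl.length).filter fun j => (!Nat.beq j i) &&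
          (es.contains ((i : ℕ), j) || es.contains (j, (i : ℕ)))).length ≤
          (Finset.univ.filter fun j => j ≠ i ∧ StrongSees G (gl.get i) (gl.get j)).card := by
        rw [← List.toFinset_card_of_nodup (List.Nodup.filter _ List.nodup_range)]
        apply Finset.card_le_card_of_surjOn (fun j : Fin gl.length => (j : ℕ))
        intro j hj
        simp only [List.coe_toFinset, List.mem_filter, List.mem_range, Bool.and_eq_true,
          Bool.or_eq_true, List.contains_iff_mem, Set.mem_ofPred_eq, Bool.not_eq_true'] at hj
        obtain ⟨hj, hji, hje⟩ := hj
        refine ⟨⟨j, hj⟩, ?_, rfl⟩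
        simp only [Finset.coe_filter, Finset.mem_univ, true_and, Set.mem_ofPred_eq]
        refine ⟨fun h => ?_, ?_⟩
        · have := Nat.ne_of_beq_eq_false hji
          exact this (congrArg Fin.val h)
        · rcases hje with h | h
          · have := hs _ h
            rw [← hgd, ← hgd]; exact this
          · have := hs _ h
            rw [← hgd, ← hgd]; exact sees_symm this
      omega
    have hβ : Nonempty β := by
      by_contra h
      rw [not_nonempty_iff] at h
      have h1 : gl ≠ [] := fun h => by
        have := hv w hvw
        rw [h] at this; simp at this
      have h2 := hsz ⟨0, List.length_pos_iff.2 h1⟩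
      have : F ⟨0, List.length_pos_iff.2 h1⟩ = ∅ := Finset.eq_empty_of_isEmpty _
      have h3 := hpos 0 (List.length_pos_iff.2 h1)
      rw [this] at h2
      simp only [Finset.card_empty] at h2
      omega
    obtain ⟨b⟩ := hβ
    obtain ⟨s, hs1, hs2⟩ := hcl
      (fun i => if h : (i : ℕ) < gl.length then F ⟨i, h⟩ else {b}) (fun i h => by
        simp only [dif_pos h]; exact hsz ⟨i, h⟩) (fun i => by
        by_cases h : (i : ℕ) < gl.length
        · simp only [dif_pos h]
          exact Finset.card_pos.1 ((hpos i h).trans_le (hsz ⟨i, h⟩))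
        · simp only [dif_neg h]
          simp)
    have hof : ∀ i : Fin gl.length, Fin.ofNat 10 (i : ℕ) = ⟨i, i.2.trans_le hk⟩ := by
      intro i
      ext
      simp [Fin.ofNat, Nat.mod_eq_of_lt (i.2.trans_le hk)]
    refine ⟨fun i => s ⟨i, i.2.trans_le hk⟩, fun i => ?_, fun i j hij hss => ?_⟩
    · have := hs1 ⟨i, i.2.trans_le hk⟩
      simpa only [dif_pos i.2] using this
    · rcases hiff i j hij hss with h | h
      · have := hs2 _ h
        simpa only [hof] using this
      · have := hs2 _ h
        simp only [hof] at this
        exact this.symm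

/-- all numerical conditions for a reducible configuration -/
noncomputable def chk (k : ℕ) (es non : List (ℕ × ℕ)) (t : ℕ) (m : List ℕ) : Bool :=
  chc k es non ((List.range k).map fun i => dig t i + 1) m &&
  frc t (fun t => run es [(t, 1)]) &&
  Nat.beq ((List.range 10).map (dig t)).sum es.length &&
  (List.range 10).all (fun i => Nat.blt i k || Nat.beq (dig t i) 0)

theorem red_false {G : SimpleGraph V} [DecidableRel G.Adj] {L : Sym2 V → Finset β} (C : Ctx G L)
    (k : ℕ) (gl : List (Sym2 V)) (hk : gl.length = k) (d : Sym2 V) (es non : List (ℕ × ℕ))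
    (t : ℕ) (ml : List ℕ) (hchk : chk k es non t ml = true)
    (hnd : gl.Nodup) (hge : ∀ e ∈ gl, e ∈ G.edgeSet)
    (v w : V) (hvw : G.Adj v w) (hv : ∀ x, G.Adj v x → s(v, x) ∈ gl)
    (hm : ∀ p ∈ gl.zip ml, (nb G p.1).card ≤ p.2) (hml : ml.length = k)
    (hs : ∀ p ∈ es, StrongSees G (gl.getD p.1 d) (gl.getD p.2 d))
    (hns : ∀ p ∈ non, ¬ StrongSees G (gl.getD p.1 d) (gl.getD p.2 d)) : False := by
  rw [chk, Bool.and_eq_true, Bool.and_eq_true, Bool.and_eq_true, frc_eq] at hchk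
  obtain ⟨⟨⟨hc, hr⟩, hdeg⟩, hz⟩ := hchk
  simp only [List.all_eq_true, List.mem_range, Bool.or_eq_true, Nat.blt_eq, Nat.beq_eq] at hz hdeg
  refine red_core C k gl hk d es non _ ml hc ?_ hnd hge v w hvw hv hm hml hs hns
  intro S hS hS'
  simp only [chc, Bool.and_eq_true, List.all_eq_true, Nat.ble_eq, Nat.blt_eq] at hc
  have h10 := hc.1.1.1.1
  refine gen_col es (fun e he => ?_) t hr hdeg S (fun i => ?_)
  · have := hc.1.1.1.2 e he
    exact ⟨this.1.trans_le h10, this.2.trans_le h10⟩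
  · by_cases h : (i : ℕ) < k
    · have := hS i h
      rw [List.getD_eq_getElem _ _ (by simpa using h)] at this
      simp only [List.getElem_map, List.getElem_range] at this
      omega
    · rcases hz i i.2 with h1 | h1
      · exact absurd h1 h
      · rw [h1]
        exact Finset.card_pos.2 (hS' i)

end graph

end FC


namespace FC

section graph2

set_option linter.unusedSectionVars false

variable {V β : Type*} [Fintype V]

open scoped Classical in
noncomputable def inc (G : SimpleGraph V) (w : V) : Finset (Sym2 V) :=
  Finset.univ.filter fun y => y ∈ G.edgeSet ∧ w ∈ y

theorem mem_inc {G : SimpleGraph V} {w : V} {e : Sym2 V} :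
    e ∈ inc G w ↔ e ∈ G.edgeSet ∧ w ∈ e := by
  simp [inc]

theorem mem_inc_l {G : SimpleGraph V} {w x : V} (h : G.Adj w x) : s(w, x) ∈ inc G w := by
  rw [mem_inc]; exact ⟨h, by simp⟩

theorem mem_inc_r {G : SimpleGraph V} {w x : V} (h : G.Adj w x) : s(w, x) ∈ inc G x := by
  rw [mem_inc]; exact ⟨h, by simp⟩

open scoped Classical in
theorem card_inc {G : SimpleGraph V} [DecidableRel G.Adj] {L : Sym2 V → Finset β} (C : Ctx G L)
    (w : V) : (inc G w).card ≤ 3 := by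
  refine le_trans ?_ (C.deg w)
  rw [← G.card_neighborFinset_eq_degree]
  refine le_trans (Finset.card_le_card (t := (G.neighborFinset w).image fun x => s(w, x)) ?_)
    Finset.card_image_le
  intro e he
  rw [mem_inc] at he
  obtain ⟨x, rfl⟩ := Sym2.mem_iff_exists.1 he.2
  exact Finset.mem_image.2 ⟨x, by simpa using he.1, rfl⟩

/-- neighbours of `x` are among `y`, `p`, `q` -/
def Nbr (G : SimpleGraph V) (x y p q : V) : Prop := ∀ z, G.Adj x z → z = y ∨ z = p ∨ z = q

theorem Nbr.swap {G : SimpleGraph V} {x y p q : V} (h : Nbr G x y p q) : Nbr G x y q p := by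
  intro z hz
  rcases h z hz with h | h | h <;> simp [h]

theorem Nbr.rot {G : SimpleGraph V} {x y p q : V} (h : Nbr G x y p q) : Nbr G x p q y := by
  intro z hz
  rcases h z hz with h | h | h <;> simp [h]

open scoped Classical in
theorem nb_sub {G : SimpleGraph V} {x y p q r s : V} (hx : Nbr G x y p q) (hy : Nbr G y x r s) :
    nb G s(x, y) ⊆ (inc G p ∪ inc G q) ∪ (inc G r ∪ inc G s) := by
  intro e he
  simp only [nb, Finset.mem_filter, Finset.mem_univ, true_and] at he
  obtain ⟨he, hne, hs⟩ := he
  simp only [Finset.mem_union, mem_inc, he, true_and]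
  induction e using Sym2.ind with
  | _ z w =>
    have hzw : G.Adj z w := he
    have hX : ∀ z w, G.Adj z w → s(z, w) ≠ s(x, y) → (x = z ∨ y = z ∨ G.Adj x z ∨ G.Adj y z) →
        ((p ∈ s(z, w) ∨ q ∈ s(z, w)) ∨ (r ∈ s(z, w) ∨ s ∈ s(z, w))) := by
      intro z w hzw hne h
      simp only [Sym2.mem_iff]
      have h1 : ∀ w, G.Adj x w → w ≠ y → p = w ∨ q = w := by
        intro w hw hne
        rcases hx w hw with h | h | h
        · exact absurd h hne
        · exact Or.inl h.symm
        · exact Or.inr h.symm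
      have h2 : ∀ w, G.Adj y w → w ≠ x → r = w ∨ s = w := by
        intro w hw hne
        rcases hy w hw with h | h | h
        · exact absurd h hne
        · exact Or.inl h.symm
        · exact Or.inr h.symm
      have h3 : G.Adj x w → w ≠ y → ((p = z ∨ p = w) ∨ (q = z ∨ q = w)) ∨
          ((r = z ∨ r = w) ∨ (s = z ∨ s = w)) := fun a b => by
        rcases h1 w a b with h | h <;> simp [h]
      have h4 : G.Adj x z → z ≠ y → ((p = z ∨ p = w) ∨ (q = z ∨ q = w)) ∨
          ((r = z ∨ r = w) ∨ (s = z ∨ s = w)) := fun a b => by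
        rcases h1 z a b with h | h <;> simp [h]
      have h5 : G.Adj y w → w ≠ x → ((p = z ∨ p = w) ∨ (q = z ∨ q = w)) ∨
          ((r = z ∨ r = w) ∨ (s = z ∨ s = w)) := fun a b => by
        rcases h2 w a b with h | h <;> simp [h]
      have h6 : G.Adj y z → z ≠ x → ((p = z ∨ p = w) ∨ (q = z ∨ q = w)) ∨
          ((r = z ∨ r = w) ∨ (s = z ∨ s = w)) := fun a b => by
        rcases h2 z a b with h | h <;> simp [h]
      have hX : ∀ z, x = z → G.Adj z w → s(z, w) ≠ s(x, y) → G.Adj x w ∧ w ≠ y := by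
        rintro z rfl hzw hne
        exact ⟨hzw, fun h => hne (by rw [h])⟩
      have hY : ∀ z, y = z → G.Adj z w → s(z, w) ≠ s(x, y) → G.Adj y w ∧ w ≠ x := by
        rintro z rfl hzw hne
        exact ⟨hzw, fun h => hne (by rw [h, Sym2.eq_swap])⟩
      by_cases hxz : x = z
      · exact h3 (hX z hxz hzw hne).1 (hX z hxz hzw hne).2
      by_cases hyz : y = z
      · exact h5 (hY z hyz hzw hne).1 (hY z hyz hzw hne).2
      rcases h with h | h | h | h
      · exact absurd h hxz
      · exact absurd h hyz
      · exact h4 h (fun h => hyz h.symm)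
      · exact h6 h (fun h => hxz h.symm)
    rw [sees_mk] at hs
    have hsw : s(z, w) = s(w, z) := Sym2.eq_swap
    rcases hs with (h | h | h | h) | (h | h | h | h)
    · exact hX z w hzw hne (by simp [h])
    · rw [hsw]; exact hX w z hzw.symm (hsw ▸ hne) (by simp [h])
    · exact hX z w hzw hne (by simp [h])
    · rw [hsw]; exact hX w z hzw.symm (hsw ▸ hne) (by simp [h])
    · exact hX z w hzw hne (by simp [h])
    · rw [hsw]; exact hX w z hzw.symm (hsw ▸ hne) (by simp [h])
    · exact hX z w hzw hne (by simp [h])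
    · rw [hsw]; exact hX w z hzw.symm (hsw ▸ hne) (by simp [h])

theorem card_un {α : Type*} [DecidableEq α] (A B : Finset α) : (A ∪ B).card ≤ A.card + B.card :=
  Finset.card_union_le A B

theorem card_un1 {α : Type*} [DecidableEq α] (A B : Finset α) (e : α) (h1 : e ∈ A) (h2 : e ∈ B) :
    (A ∪ B).card + 1 ≤ A.card + B.card := by
  have := Finset.card_union_add_card_inter A B
  have h3 : 0 < (A ∩ B).card := Finset.card_pos.2 ⟨e, Finset.mem_inter.2 ⟨h1, h2⟩⟩
  omega

section
variable {G : SimpleGraph V} [DecidableRel G.Adj] {L : Sym2 V → Finset β} (C : Ctx G L)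
  {x y p q r s : V} (hx : Nbr G x y p q) (hy : Nbr G y x r s)

include C hx hy

open scoped Classical in
theorem nb12 : (nb G s(x, y)).card ≤ 12 := by
  refine (Finset.card_le_card (nb_sub hx hy)).trans ?_
  have h1 := card_un (inc G p ∪ inc G q) (inc G r ∪ inc G s)
  have h2 := card_un (inc G p) (inc G q)
  have h3 := card_un (inc G r) (inc G s)
  have := card_inc C p
  have := card_inc C q
  have := card_inc C r
  have := card_inc C s
  omega

open scoped Classical in
theorem nb11 (h : G.Adj p r) : (nb G s(x, y)).card ≤ 11 := by
  refine (Finset.card_le_card (nb_sub hx hy)).trans ?_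
  have h1 := card_un1 (inc G p ∪ inc G q) (inc G r ∪ inc G s) s(p, r)
    (Finset.mem_union_left _ (mem_inc_l h)) (Finset.mem_union_left _ (mem_inc_r h))
  have h2 := card_un (inc G p) (inc G q)
  have h3 := card_un (inc G r) (inc G s)
  have := card_inc C p
  have := card_inc C q
  have := card_inc C r
  have := card_inc C s
  omega

open scoped Classical in
theorem nb11t (h : G.Adj p q) : (nb G s(x, y)).card ≤ 11 := by
  refine (Finset.card_le_card (nb_sub hx hy)).trans ?_
  have h1 := card_un (inc G p ∪ inc G q) (inc G r ∪ inc G s)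
  have h2 := card_un1 (inc G p) (inc G q) s(p, q) (mem_inc_l h) (mem_inc_r h)
  have h3 := card_un (inc G r) (inc G s)
  have := card_inc C p
  have := card_inc C q
  have := card_inc C r
  have := card_inc C s
  omega

open scoped Classical in
theorem nb9 (h : p = r) : (nb G s(x, y)).card ≤ 9 := by
  have h0 := nb_sub hx hy
  have h4 : (inc G p ∪ inc G q) ∪ (inc G r ∪ inc G s) ⊆ (inc G p ∪ inc G q) ∪ inc G s := by
    rw [h]; intro e; simp only [Finset.mem_union]; tauto
  refine (Finset.card_le_card (h0.trans h4)).trans ?_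
  have h1 := card_un (inc G p ∪ inc G q) (inc G s)
  have h2 := card_un (inc G p) (inc G q)
  have := card_inc C p
  have := card_inc C q
  have := card_inc C s
  omega

open scoped Classical in
theorem nb9d (h : p = q) : (nb G s(x, y)).card ≤ 9 := by
  have h0 := nb_sub hx hy
  have h4 : (inc G p ∪ inc G q) ∪ (inc G r ∪ inc G s) ⊆ (inc G p ∪ inc G r) ∪ inc G s := by
    rw [h]; intro e; simp only [Finset.mem_union]; tauto
  refine (Finset.card_le_card (h0.trans h4)).trans ?_
  have h1 := card_un (inc G p ∪ inc G r) (inc G s)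
  have h2 := card_un (inc G p) (inc G r)
  have := card_inc C p
  have := card_inc C r
  have := card_inc C s
  omega

open scoped Classical in
theorem nb10 (h : G.Adj p r) (h' : G.Adj q s) : (nb G s(x, y)).card ≤ 10 := by
  have h0 := nb_sub hx hy
  have h4 : (inc G p ∪ inc G q) ∪ (inc G r ∪ inc G s) ⊆
      (inc G p ∪ inc G r) ∪ (inc G q ∪ inc G s) := by
    intro e; simp only [Finset.mem_union]; tauto
  refine (Finset.card_le_card (h0.trans h4)).trans ?_
  have h1 := card_un (inc G p ∪ inc G r) (inc G q ∪ inc G s)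
  have h2 := card_un1 (inc G p) (inc G r) s(p, r) (mem_inc_l h) (mem_inc_r h)
  have h3 := card_un1 (inc G q) (inc G s) s(q, s) (mem_inc_l h') (mem_inc_r h')
  have := card_inc C p
  have := card_inc C q
  have := card_inc C r
  have := card_inc C s
  omega

open scoped Classical in
theorem nb9p (h : G.Adj p r) (h' : G.Adj r q) (h2 : G.Adj q s) :
    (nb G s(x, y)).card ≤ 9 := by
  have h0 := nb_sub hx hy
  have h4 : (inc G p ∪ inc G q) ∪ (inc G r ∪ inc G s) ⊆
      ((inc G p ∪ inc G r) ∪ inc G q) ∪ inc G s := by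
    intro e; simp only [Finset.mem_union]; tauto
  refine (Finset.card_le_card (h0.trans h4)).trans ?_
  have h1 := card_un1 ((inc G p ∪ inc G r) ∪ inc G q) (inc G s) s(q, s)
    (Finset.mem_union_right _ (mem_inc_l h2)) (mem_inc_r h2)
  have h3 := card_un1 (inc G p ∪ inc G r) (inc G q) s(r, q)
    (Finset.mem_union_right _ (mem_inc_l h')) (mem_inc_r h')
  have h3 := card_un1 (inc G p) (inc G r) s(p, r) (mem_inc_l h) (mem_inc_r h)
  have := card_inc C p
  have := card_inc C q
  have := card_inc C r
  have := card_inc C s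
  omega

end

/-- every vertex has its neighbours within a triple containing a given neighbour -/
theorem exNbr {G : SimpleGraph V} [DecidableRel G.Adj] {L : Sym2 V → Finset β} (C : Ctx G L)
    {x y : V} (h : G.Adj x y) : ∃ p q, Nbr G x y p q := by
  classical
  have h1 : ((G.neighborFinset x).erase y).card ≤ 2 := by
    rw [Finset.card_erase_of_mem (by simpa using h), G.card_neighborFinset_eq_degree]
    have := C.deg x
    omega
  have h2 : ∃ p q, (G.neighborFinset x).erase y ⊆ {p, q} := by
    rcases Nat.lt_or_ge 1 ((G.neighborFinset x).erase y).card with h | h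
    · have : ((G.neighborFinset x).erase y).card = 2 := by omega
      obtain ⟨p, q, -, hpq⟩ := Finset.card_eq_two.1 this
      exact ⟨p, q, hpq.le⟩
    · have : Nonempty V := ⟨x⟩
      obtain ⟨p, hp⟩ := Finset.card_le_one_iff_subset_singleton.1 h
      exact ⟨p, p, hp.trans (by simp)⟩
  obtain ⟨p, q, hpq⟩ := h2
  refine ⟨p, q, fun z hz => ?_⟩
  by_cases hzy : z = y
  · exact Or.inl hzy
  · have := hpq (Finset.mem_erase.2 ⟨hzy, by simpa using hz⟩)
    simp only [Finset.mem_insert, Finset.mem_singleton] at this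
    exact Or.inr this

theorem deg3 {G : SimpleGraph V} [DecidableRel G.Adj] {L : Sym2 V → Finset β} (C : Ctx G L)
    {v a b : V} (ha : G.Adj v a) (hb : G.Adj v b) (hab : a ≠ b) :
    ∃ c, G.Adj v c ∧ c ≠ a ∧ c ≠ b ∧ Nbr G v a b c := by
  by_contra hcon
  have hN : ∀ z, G.Adj v z → z = a ∨ z = b := by
    by_contra h
    push Not at h
    obtain ⟨c, hc, hca, hcb⟩ := h
    refine hcon ⟨c, hc, hca, hcb, ?_⟩
    intro z hz
    by_contra h
    simp only [not_or] at h
    have := C.deg v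
    classical
    rw [← G.card_neighborFinset_eq_degree] at this
    have h4 : ({a, b, c, z} : Finset V) ⊆ G.neighborFinset v := by
      intro y hy
      simp only [Finset.mem_insert, Finset.mem_singleton] at hy
      rcases hy with rfl | rfl | rfl | rfl <;> simpa
    have h5 := Finset.card_le_card h4
    have h6 : ({a, b, c, z} : Finset V).card = 4 := by
      rw [Finset.card_insert_of_notMem, Finset.card_insert_of_notMem, Finset.card_insert_of_notMem,
        Finset.card_singleton]
      · simp; exact fun h' => h.2.2 h'.symm
      · simp; exact ⟨fun h => hcb h.symm, fun h' => h.2.1 h'.symm⟩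
      · simp; exact ⟨hab, fun h => hca h.symm, fun h' => h.1 h'.symm⟩
    omega
  obtain ⟨p, q, hpq⟩ := exNbr C ha.symm
  obtain ⟨r, s, hrs⟩ := exNbr C hb.symm
  have hva : Nbr G v a b b := fun z hz => by rcases hN z hz with h | h <;> simp [h]
  have hvb : Nbr G v b a a := fun z hz => by rcases hN z hz with h | h <;> simp [h]
  refine red_false C 2 [s(v, a), s(v, b)] rfl s(v, a) [(0, 1)] [] 1 [9, 9] (by decide +kernel)
    ?_ ?_ v a ha ?_ ?_ rfl ?_ (by simp)
  · have := ha.ne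
    have := hb.ne
    simp [hab, hb.ne]
  · simp [ha, hb]
  · intro x hx
    rcases hN x hx with rfl | rfl <;> simp
  · simp only [List.zip_cons_cons, List.zip_nil_right, List.forall_mem_cons]
    exact ⟨nb9d C hva hpq rfl, nb9d C hvb hrs rfl, by simp⟩
  · simp [sees_mk]

end graph2

end FC


namespace FC

section graph3

set_option linter.unusedSectionVars false
set_option linter.unusedSimpArgs false

variable {V β : Type*} [Fintype V]

theorem nbr3 {G : SimpleGraph V} [DecidableRel G.Adj] {L : Sym2 V → Finset β} (C : Ctx G L)
    {v a b c : V} (ha : G.Adj v a) (hb : G.Adj v b) (hc : G.Adj v c) (hab : a ≠ b) (hac : a ≠ c)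
    (hbc : b ≠ c) : Nbr G v a b c := by
  obtain ⟨c', hc', -, -, h⟩ := deg3 C ha hb hab
  rcases h c hc with h1 | h1 | h1
  · exact absurd h1.symm hac
  · exact absurd h1.symm hbc
  · rw [h1]; exact h

theorem no_tri {G : SimpleGraph V} [DecidableRel G.Adj] {L : Sym2 V → Finset β} (C : Ctx G L)
    {a b c : V} (hab : G.Adj a b) (hbc : G.Adj b c) (hca : G.Adj c a) : False := by
  obtain ⟨a', ha, ha1, ha2, hA⟩ := deg3 C hab hca.symm hbc.ne
  obtain ⟨b', hb, hb1, hb2, hB⟩ := deg3 C hbc hab.symm hca.ne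
  obtain ⟨c', hc, hc1, hc2, hC⟩ := deg3 C hca hbc.symm hab.ne
  obtain ⟨p, q, hpq⟩ := exNbr C ha.symm
  obtain ⟨p1, q1, hpq1⟩ := exNbr C hb.symm
  obtain ⟨p2, q2, hpq2⟩ := exNbr C hc.symm
  refine red_false C 6 [s(a, a'), s(b, b'), s(c, c'), s(a, b), s(b, c), s(c, a)] rfl s(a, b)
      [(0, 1), (0, 2), (0, 3), (0, 4), (0, 5), (1, 2), (1, 3), (1, 4), (1, 5), (2, 3), (2, 4), (2,
        5), (3, 4), (3, 5), (4, 5)]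
    [] 19027 [11, 11, 11, 9, 9, 9] (by decide +kernel) ?_ ?_ a b hab ?_ ?_ rfl ?_ (by simp)
  · have := hab.ne
    have := hab.ne.symm
    have := hbc.ne
    have := hbc.ne.symm
    have := hca.ne
    have := hca.ne.symm
    simp [*]
  · simp [*]
  · intro x hx
    rcases hA x hx with rfl | rfl | rfl <;> simp
  · simp only [List.zip_cons_cons, List.zip_nil_right, List.forall_mem_cons]
    exact ⟨nb11t C hA.rot.rot hpq hbc, nb11t C hB.rot.rot hpq1 hca, nb11t C hC.rot.rot hpq2 hab,
      nb9 C hA hB.rot.swap rfl, nb9 C hB hC.rot.swap rfl, nb9 C hC hA.rot.swap rfl, by simp⟩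
  · simp [sees_mk, hab, hbc, hca, hab.symm, hbc.symm, hca.symm]

def thb : List (ℕ × ℕ) :=
    [(0, 1), (0, 2), (0, 3), (0, 4), (0, 5), (0, 6), (0, 7), (0, 8), (1, 2), (1, 3), (1, 4), (1,
        5), (1, 6), (1, 7), (1, 8), (2, 3), (2, 4), (2, 5), (2, 6), (2, 7), (3, 4), (3, 5), (3,
        6), (3, 7), (4, 5), (4, 6), (4, 7), (4, 8), (5, 6), (5, 7), (5, 8), (6, 8)]

theorem thA {G : SimpleGraph V} [DecidableRel G.Adj] {L : Sym2 V → Finset β} (C : Ctx G L)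
    {a b c d x y b' d' x' y' : V} (hab : G.Adj a b) (had : G.Adj a d) (hbc : G.Adj b c)
    (hcd : G.Adj c d) (hax : G.Adj a x) (hcy : G.Adj c y) (hxy : G.Adj x y) (hb : G.Adj b b')
    (hx : G.Adj x x') (nA : Nbr G a b d x) (nC : Nbr G c b d y) (nB : Nbr G b a c b')
    (nD : Nbr G d a c d') (nX : Nbr G x a y x') (nY : Nbr G y c x y')
    (hnd : [s(a, b), s(a, d), s(b, c), s(c, d), s(a, x), s(c, y), s(x, y), s(b, b'),
      s(x, x')].Nodup)
    (h1 : ¬ StrongSees G s(x, y) s(b, b')) (h2 : ¬ StrongSees G s(b, c) s(x, x')) : False := by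
  obtain ⟨p, q, hpq⟩ := exNbr C hb.symm
  obtain ⟨r, s, hrs⟩ := exNbr C hx.symm
  have main : ∀ (es non : List (ℕ × ℕ)) (t : ℕ),
      chk 9 es non t [11, 11, 11, 11, 12, 12, 12, 12, 12] = true →
      (∀ p ∈ es, StrongSees G (List.getD [s(a, b), s(a, d), s(b, c), s(c, d), s(a, x), s(c, y),
        s(x, y), s(b, b'), s(x, x')] p.1 s(a, b)) (List.getD [s(a, b), s(a, d), s(b, c), s(c, d),
        s(a, x), s(c, y), s(x, y), s(b, b'), s(x, x')] p.2 s(a, b))) →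
      (∀ p ∈ non, ¬ StrongSees G (List.getD [s(a, b), s(a, d), s(b, c), s(c, d), s(a, x), s(c, y),
        s(x, y), s(b, b'), s(x, x')] p.1 s(a, b)) (List.getD [s(a, b), s(a, d), s(b, c), s(c, d),
        s(a, x), s(c, y), s(x, y), s(b, b'), s(x, x')] p.2 s(a, b))) → False := by
    intro es non t hchk hs hns
    refine red_false C 9 _ rfl s(a, b) es non t _ hchk hnd ?_ a b hab ?_ ?_ rfl hs hns
    · simp [*]
    · intro z hz
      rcases nA z hz with rfl | rfl | rfl <;> simp
    · simp only [List.zip_cons_cons, List.zip_nil_right, List.forall_mem_cons]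
      exact ⟨nb11 C nA nB hcd.symm, nb11 C nA.rot.swap nD hbc, nb11 C nB.rot.swap nC
        had,
        nb11 C nC.rot.swap nD.rot.swap hab.symm, nb12 C nA.rot.rot nX, nb12 C nC.rot.rot nY,
        nb12 C nX.rot nY.rot, nb12 C nB.rot.rot hpq, nb12 C nX.rot.rot hrs, by simp⟩
  have hbase : ∀ p ∈ thb, StrongSees G (List.getD [s(a, b), s(a, d), s(b, c), s(c, d), s(a, x),
        s(c, y), s(x, y), s(b, b'), s(x, x')] p.1 s(a, b)) (List.getD [s(a, b), s(a, d), s(b, c),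
        s(c, d), s(a, x), s(c, y), s(x, y), s(b, b'), s(x, x')] p.2 s(a, b)) := by
    simp [thb, sees_mk, hab, had, hbc, hcd, hax, hcy, hxy, hb, hx, hab.symm, had.symm, hbc.symm,
      hcd.symm, hax.symm, hcy.symm, hxy.symm, hb.symm, hx.symm]
  by_cases h3 : StrongSees G s(b, b') s(x, x') <;> by_cases h4 : StrongSees G s(c, d) s(x, x')
  · refine main (thb ++ [(7, 8), (3, 8)]) [(6, 7), (2, 8)] 59848949 (by decide +kernel) ?_ ?_
    · rw [List.forall_mem_append]
      exact ⟨hbase, by simpa using ⟨h3, h4⟩⟩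
    · simpa using ⟨h1, h2⟩
  · refine main (thb ++ [(7, 8)]) [(6, 7), (2, 8), (3, 8)] 26297710 (by decide +kernel) ?_ ?_
    · rw [List.forall_mem_append]
      exact ⟨hbase, by simpa using h3⟩
    · simpa using ⟨h1, h2, h4⟩
  · refine main (thb ++ [(3, 8)]) [(6, 7), (2, 8), (7, 8)] 38882142 (by decide +kernel) ?_ ?_
    · rw [List.forall_mem_append]
      exact ⟨hbase, by simpa using h4⟩
    · simpa using ⟨h1, h2, h3⟩
  · refine main thb [(6, 7), (2, 8), (7, 8), (3, 8)] 41002798 (by decide +kernel) hbase ?_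
    simpa using ⟨h1, h2, h3, h4⟩

theorem thB {G : SimpleGraph V} [DecidableRel G.Adj] {L : Sym2 V → Finset β} (C : Ctx G L)
    {a b c d x y q d' y' q' : V} (hab : G.Adj a b) (had : G.Adj a d) (hbc : G.Adj b c)
    (hcd : G.Adj c d) (hax : G.Adj a x) (hcy : G.Adj c y) (hxy : G.Adj x y) (hb : G.Adj b q)
    (hx : G.Adj x q) (nA : Nbr G a b d x) (nC : Nbr G c b d y) (nB : Nbr G b a c q)
    (nD : Nbr G d a c d') (nX : Nbr G x a y q) (nY : Nbr G y c x y') (nQ : Nbr G q b x q')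
    (hnd : [s(a, b), s(a, d), s(b, c), s(c, d), s(a, x), s(c, y), s(x, y), s(b, q),
      s(x, q)].Nodup)
    (h1 : ¬ StrongSees G s(c, d) s(x, q)) : False := by
  refine red_false C 9 _ rfl s(a, b) [(0, 1), (0, 2), (0, 3), (0, 4), (0, 5), (0, 6), (0, 7),
        (0, 8), (1, 2), (1, 3), (1, 4), (1, 5), (1, 6), (1, 7), (1, 8), (2, 3), (2, 4), (2, 5),
        (2, 6), (2, 7), (2, 8), (3, 4), (3, 5), (3, 6), (3, 7), (4, 5), (4, 6), (4, 7), (4, 8),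
        (5, 6), (5, 7), (5, 8), (6, 7), (6, 8), (7, 8)]
      [(3, 8)] 56969591 [10, 11, 11, 11, 11, 12, 12, 11, 11] (by decide +kernel) hnd ?_ a b hab ?_
        ?_ rfl ?_ ?_
  · simp [*]
  · intro z hz
    rcases nA z hz with rfl | rfl | rfl <;> simp
  · simp only [List.zip_cons_cons, List.zip_nil_right, List.forall_mem_cons]
    exact ⟨nb10 C nA nB hcd.symm hx, nb11 C nA.rot.swap nD hbc, nb11 C nB.rot.swap nC had,
      nb11 C nC.rot.swap nD.rot.swap hab.symm, nb11 C nA.rot.rot nX.swap hb, nb12 C nC.rot.rot nY,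
      nb12 C nX.rot nY.rot, nb11 C nB.rot.rot nQ hax, nb11 C nX.rot.rot nQ.rot.swap hab, by simp⟩
  · simp [sees_mk, hab, had, hbc, hcd, hax, hcy, hxy, hb, hx, hab.symm, had.symm, hbc.symm,
      hcd.symm, hax.symm, hcy.symm, hxy.symm, hb.symm, hx.symm]
  · simpa using h1

theorem thC {G : SimpleGraph V} [DecidableRel G.Adj] {L : Sym2 V → Finset β} (C : Ctx G L)
    {a b c d x y q : V} (hab : G.Adj a b) (had : G.Adj a d) (hbc : G.Adj b c)
    (hcd : G.Adj c d) (hax : G.Adj a x) (hb : G.Adj b q) (hd : G.Adj d q)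
    (hx : G.Adj x q) (nA : Nbr G a b d x) (nB : Nbr G b a c q)
    (nD : Nbr G d a c q) (nX : Nbr G x a y q)
    (hbd : b ≠ d) (hbx : b ≠ x) (hdx : d ≠ x) : False := by
  refine red_false C 3 [s(a, x), s(a, b), s(a, d)] rfl s(a, b) [(0, 1), (0, 2), (1, 2)]
    [] 136 [11, 9, 9] (by decide +kernel) ?_ ?_ a b hab ?_ ?_ rfl ?_ (by simp)
  · simp [hbd, hbx.symm, hdx.symm, hab.ne, had.ne, hax.ne]
  · simp [*]
  · intro z hz
    rcases nA z hz with rfl | rfl | rfl <;> simp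
  · simp only [List.zip_cons_cons, List.zip_nil_right, List.forall_mem_cons]
    exact ⟨nb11 C nA.rot.rot nX.swap hb, nb9p C nA.swap nB.swap hx hd.symm hcd.symm,
      nb9p C nA.rot nD.swap hx hb.symm hbc, by simp⟩
  · simp [sees_mk]

end graph3

end FC


namespace FC

section graph4

set_option linter.unusedSectionVars false
set_option linter.unusedSimpArgs false

variable {V β : Type*} [Fintype V]

theorem th_nd {a b c d x y b' x' : V} (h1 : a ≠ b) (h2 : a ≠ c) (h3 : a ≠ d) (h4 : a ≠ x)
    (h5 : a ≠ y) (h6 : b ≠ c) (h7 : b ≠ d) (h8 : b ≠ x) (h9 : b ≠ y) (h10 : c ≠ d) (h11 : c ≠ x)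
    (h12 : c ≠ y) (h13 : d ≠ x) (h14 : d ≠ y) (h15 : x ≠ y) (k1 : b' ≠ a) (k2 : b' ≠ c)
    (k3 : x' ≠ a) (k4 : x' ≠ y) (k5 : x' ≠ b) (k6 : b' ≠ x) :
    [s(a, b), s(a, d), s(b, c), s(c, d), s(a, x), s(c, y), s(x, y), s(b, b'),
      s(x, x')].Nodup := by
  simp [h1, h2, h3, h4, h5, h6, h7, h8, h9, h10, h11, h12, h13, h14, h15, k1, k2, k3, k4, k5, k6,
    h1.symm, h2.symm, h3.symm, h4.symm, h5.symm, h6.symm, h7.symm, h8.symm, h9.symm, h10.symm,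
    h11.symm, h12.symm, h13.symm, h14.symm, h15.symm, k1.symm, k2.symm, k3.symm, k4.symm, k5.symm,
    k6.symm]

theorem thBC {G : SimpleGraph V} [DecidableRel G.Adj] {L : Sym2 V → Finset β} (C : Ctx G L)
    {a b c d x y q : V} (hab : G.Adj a b) (had : G.Adj a d) (hbc : G.Adj b c)
    (hcd : G.Adj c d) (hax : G.Adj a x) (hcy : G.Adj c y) (hxy : G.Adj x y)
    (hac : a ≠ c) (hbd : b ≠ d) (hbx : b ≠ x) (hdx : d ≠ x) (hby : b ≠ y) (hdy : d ≠ y)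
    (hcx : c ≠ x) (hay : a ≠ y) (hbq : G.Adj b q) (hxq : G.Adj x q) (hqa : q ≠ a) (hqc : q ≠ c)
    (hqy : q ≠ y) : False := by
  have nA := nbr3 C hab had hax hbd hbx hdx
  have nC := nbr3 C hbc.symm hcd hcy hbd hby hdy
  have nB := nbr3 C hab.symm hbc hbq hac hqa.symm hqc.symm
  have nX := nbr3 C hax.symm hxy hxq hay hqa.symm hqy.symm
  obtain ⟨d', hd, hda, hdc, nD⟩ := deg3 C had.symm hcd.symm hac
  obtain ⟨y', hy, hyc, hyx, nY⟩ := deg3 C hcy.symm hxy.symm hcx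
  obtain ⟨q', hq, hqb, hqx, nQ⟩ := deg3 C hbq.symm hxq.symm hbx
  have hqd : q ≠ d := by rintro rfl; exact no_tri C hab hbq had.symm
  by_cases hdq : d' = q
  · subst hdq
    exact thC C hab had hbc hcd hax hbq hd hxq nA nB nD nX hbd hbx hdx
  · refine thB C hab had hbc hcd hax hcy hxy hbq hxq nA nC nB nD nX nY nQ
      (th_nd hab.ne hac had.ne hax.ne hay hbc.ne hbd hbx hby hcd.ne hcx hcy.ne hdx hdy hxy.ne
        hqa hqc hqa hqy hbq.ne.symm hxq.ne.symm) ?_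
    rw [sees_mk]
    rintro ((h | h | h | h) | (h | h | h | h))
    · exact hcx h
    · exact hqc h.symm
    · exact hdx h
    · exact hqd h.symm
    · exact no_tri C h hxy hcy.symm
    · rcases nC q h with h | h | h
      · exact hbq.ne h.symm
      · exact hqd h
      · exact hqy h
    · exact no_tri C h hax.symm had
    · rcases nD q h with h | h | h
      · exact hqa h
      · exact hqc h
      · exact hdq h.symm

theorem no_theta {G : SimpleGraph V} [DecidableRel G.Adj] {L : Sym2 V → Finset β} (C : Ctx G L)
    {a b c d x y : V} (hab : G.Adj a b) (had : G.Adj a d) (hbc : G.Adj b c)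
    (hcd : G.Adj c d) (hax : G.Adj a x) (hcy : G.Adj c y) (hxy : G.Adj x y)
    (hac : a ≠ c) (hbd : b ≠ d) (hbx : b ≠ x) (hdx : d ≠ x) (hby : b ≠ y) (hdy : d ≠ y)
    (hcx : c ≠ x) (hay : a ≠ y) : False := by
  have nA := nbr3 C hab had hax hbd hbx hdx
  have nC := nbr3 C hbc.symm hcd hcy hbd hby hdy
  obtain ⟨b', hb, hba, hbc', nB⟩ := deg3 C hab.symm hbc hac
  obtain ⟨d', hd, hda, hdc, nD⟩ := deg3 C had.symm hcd.symm hac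
  obtain ⟨x', hx, hxa, hxy', nX⟩ := deg3 C hax.symm hxy hay
  obtain ⟨y', hy, hyc, hyx, nY⟩ := deg3 C hcy.symm hxy.symm hcx
  have b1 : b' ≠ x := by rintro rfl; exact no_tri C hab hb hax.symm
  have b2 : b' ≠ y := by rintro rfl; exact no_tri C hbc.symm hb hcy.symm
  have x1 : x' ≠ b := by rintro rfl; exact no_tri C hax hx hab.symm
  have x2 : x' ≠ d := by rintro rfl; exact no_tri C hax hx had.symm
  have x3 : x' ≠ c := by rintro rfl; exact no_tri C hxy hcy.symm hx.symm
  by_cases h1 : b' = x'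
  · subst h1
    exact thBC C hab had hbc hcd hax hcy hxy hac hbd hbx hdx hby hdy hcx hay hb hx hba hbc' hxy'
  by_cases h2 : b' = y'
  · subst h2
    exact thBC C hbc.symm hcd hab.symm had hcy hax hxy.symm hac.symm hbd hby hdy hbx hdx hay hcx
      hb hy hbc' hba b1
  refine thA C hab had hbc hcd hax hcy hxy hb hx nA nC nB nD nX nY
      (th_nd hab.ne hac had.ne hax.ne hay hbc.ne hbd hbx hby hcd.ne hcx hcy.ne hdx hdy hxy.ne
        hba hbc' hxa hxy' x1 b1) ?_ ?_
  · rw [sees_mk]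
    rintro ((h | h | h | h) | (h | h | h | h))
    · exact hbx h.symm
    · exact b1 h.symm
    · exact hby h.symm
    · exact b2 h.symm
    · exact no_tri C h hab.symm hax
    · rcases nX _ h with h | h | h
      · exact hba h
      · exact b2 h
      · exact h1 h
    · exact no_tri C h hbc hcy
    · rcases nY _ h with h | h | h
      · exact hbc' h
      · exact b1 h
      · exact h2 h
  · rw [sees_mk]
    rintro ((h | h | h | h) | (h | h | h | h))
    · exact hbx h
    · exact x1 h.symm
    · exact hcx h
    · exact x3 h.symm
    · exact no_tri C h hax.symm hab
    · rcases nB _ h with h | h | h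
      · exact hxa h
      · exact x3 h
      · exact h1 h.symm
    · exact no_tri C h hxy hcy.symm
    · rcases nC _ h with h | h | h
      · exact x1 h
      · exact x2 h
      · exact hxy' h

def non5 (b0 b1 b2 b3 b4 : Bool) : List (ℕ × ℕ) :=
  [(3, 5), (4, 6), (0, 7), (1, 8), (2, 9)] ++ (opt (!b0) (0, 2) ++ (opt (!b1) (1, 3) ++
    (opt (!b2) (2, 4) ++ (opt (!b3) (0, 3) ++ opt (!b4) (1, 4)))))

theorem chc5 : ∀ b0 b1 b2 b3 b4 : Bool, chc 10 (esb b0 b1 b2 b3 b4) (non5 b0 b1 b2 b3 b4)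
    (capf b0 b1 b2 b3 b4) [12, 12, 12, 12, 12, 12, 12, 12, 12, 12] = true := by
  decide +kernel

/-- an edge on the cycle and the opposite pendant edge do not see each other -/
theorem opp {G : SimpleGraph V} [DecidableRel G.Adj] {L : Sym2 V → Finset β} (C : Ctx G L)
    {v0 v1 v2 v3 v4 u u0 u1 : V} (h01 : G.Adj v0 v1) (h12 : G.Adj v1 v2) (h23 : G.Adj v2 v3)
    (h34 : G.Adj v3 v4) (h40 : G.Adj v4 v0) (n0 : Nbr G v0 v4 v1 u0) (n1 : Nbr G v1 v0 v2 u1)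
    (d03 : v0 ≠ v3) (d13 : v1 ≠ v3) (hu : G.Adj v3 u) (hu4 : u ≠ v4) (hu2 : u ≠ v2)
    (hu0 : u ≠ u0) (hu1 : u ≠ u1) : ¬ StrongSees G s(v3, u) s(v0, v1) := by
  have hv0 : u ≠ v0 := by rintro rfl; exact no_tri C hu h40.symm h34.symm
  have hv1 : u ≠ v1 := by rintro rfl; exact no_tri C hu h12 h23
  rw [sees_mk]
  rintro ((h | h | h | h) | (h | h | h | h))
  · exact d03 h.symm
  · exact d13 h.symm
  · exact hv0 h
  · exact hv1 h
  · exact no_tri C h h40.symm h34.symm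
  · exact no_tri C h h12 h23
  · rcases n0 _ h.symm with h | h | h
    · exact hu4 h
    · exact hv1 h
    · exact hu0 h
  · rcases n1 _ h.symm with h | h | h
    · exact hv0 h
    · exact hu2 h
    · exact hu1 h

theorem opt_all {P : ℕ × ℕ → Prop} (b : Bool) (e : ℕ × ℕ) :
    (∀ p ∈ opt b e, P p) ↔ (b = true → P e) := by
  cases b <;> simp [opt]

/-- two vertices at distance two on the cycle have different third neighbours -/
theorem third_ne {G : SimpleGraph V} [DecidableRel G.Adj] {L : Sym2 V → Finset β} (C : Ctx G L)
    {v0 v1 v2 v3 v4 u0 u2 : V} (h01 : G.Adj v0 v1) (h12 : G.Adj v1 v2) (h23 : G.Adj v2 v3)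
    (h34 : G.Adj v3 v4) (h40 : G.Adj v4 v0) (d02 : v0 ≠ v2) (d03 : v0 ≠ v3) (d13 : v1 ≠ v3)
    (d14 : v1 ≠ v4) (d24 : v2 ≠ v4) (h0 : G.Adj v0 u0) (h2 : G.Adj v2 u2) (k1 : u0 ≠ v1)
    (k2 : u0 ≠ v4) (k3 : u2 ≠ v3) : u0 ≠ u2 := by
  rintro rfl
  exact no_theta C h01 h0 h12 h2 h40.symm h23 h34.symm d02 k1.symm d14 k2 d13 k3 d24 d03

theorem no_five {G : SimpleGraph V} [DecidableRel G.Adj] {L : Sym2 V → Finset β} (C : Ctx G L)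
    {v0 v1 v2 v3 v4 : V} (h01 : G.Adj v0 v1) (h12 : G.Adj v1 v2) (h23 : G.Adj v2 v3)
    (h34 : G.Adj v3 v4) (h40 : G.Adj v4 v0) (d02 : v0 ≠ v2) (d03 : v0 ≠ v3) (d13 : v1 ≠ v3)
    (d14 : v1 ≠ v4) (d24 : v2 ≠ v4) : False := by
  classical
  obtain ⟨u0, a0, p0, q0, n0⟩ := deg3 C h40.symm h01 d14.symm
  obtain ⟨u1, a1, p1, q1, n1⟩ := deg3 C h01.symm h12 d02
  obtain ⟨u2, a2, p2, q2, n2⟩ := deg3 C h12.symm h23 d13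
  obtain ⟨u3, a3, p3, q3, n3⟩ := deg3 C h23.symm h34 d24
  obtain ⟨u4, a4, p4, q4, n4⟩ := deg3 C h34.symm h40 d03.symm
  have t02 := third_ne C h01 h12 h23 h34 h40 d02 d03 d13 d14 d24 a0 a2 q0 p0 q2
  have t13 := third_ne C h12 h23 h34 h40 h01 d13 d14 d24 d02.symm d03.symm a1 a3 q1 p1 q3
  have t24 := third_ne C h23 h34 h40 h01 h12 d24 d02.symm d03.symm d13.symm d14.symm a2 a4 q2 p2 q4
  have t30 := third_ne C h34 h40 h01 h12 h23 d03.symm d13.symm d14.symm d24.symm d02 a3 a0 q3 p3 q0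
  have t41 := third_ne C h40 h01 h12 h23 h34 d14.symm d24.symm d02 d03 d13 a4 a1 q4 p4 q1
  have o3 := opp C h01 h12 h23 h34 h40 n0 n1 d03 d13 a3 q3 p3 t30 t13.symm
  have o4 := opp C h12 h23 h34 h40 h01 n1 n2 d14 d24 a4 q4 p4 t41 t24.symm
  have o0 := opp C h23 h34 h40 h01 h12 n2 n3 d02.symm d03.symm a0 q0 p0 t02 t30.symm
  have o1 := opp C h34 h40 h01 h12 h23 n3 n4 d13.symm d14.symm a1 q1 p1 t13 t41.symm
  have o2 := opp C h40 h01 h12 h23 h34 n4 n0 d24.symm d02 a2 q2 p2 t24 t02.symm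
  obtain ⟨r0, s0, m0⟩ := exNbr C a0.symm
  obtain ⟨r1, s1, m1⟩ := exNbr C a1.symm
  obtain ⟨r2, s2, m2⟩ := exNbr C a2.symm
  obtain ⟨r3, s3, m3⟩ := exNbr C a3.symm
  obtain ⟨r4, s4, m4⟩ := exNbr C a4.symm
  refine red_core C 10 [s(v0, u0), s(v1, u1), s(v2, u2), s(v3, u3), s(v4, u4), s(v0, v1),
    s(v1, v2), s(v2, v3), s(v3, v4), s(v4, v0)] rfl s(v0, v1) _ _ _ _
    (chc5 (decide (StrongSees G s(v0, u0) s(v2, u2))) (decide (StrongSees G s(v1, u1) s(v3, u3)))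
      (decide (StrongSees G s(v2, u2) s(v4, u4))) (decide (StrongSees G s(v3, u3) s(v0, u0)))
      (decide (StrongSees G s(v4, u4) s(v1, u1))))
    (fun S hS _ => good_all β _ _ _ _ _ S (fun i => hS i i.2)) ?_ ?_ v0 v1 h01 ?_ ?_ rfl ?_ ?_
  · have e01 := h01.ne
    have e12 := h12.ne
    have e23 := h23.ne
    have e34 := h34.ne
    have e40 := h40.ne
    have w02 : u0 ≠ v2 := by rintro rfl; exact no_tri C h01 h12 a0.symm
    have w13 : u1 ≠ v3 := by rintro rfl; exact no_tri C h12 h23 a1.symm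
    have w24 : u2 ≠ v4 := by rintro rfl; exact no_tri C h23 h34 a2.symm
    have w30 : u3 ≠ v0 := by rintro rfl; exact no_tri C h34 h40 a3.symm
    have w41 : u4 ≠ v1 := by rintro rfl; exact no_tri C h40 h01 a4.symm
    simp [e01, e12, e23, e34, e40, e01.symm, e12.symm, e23.symm, e34.symm, e40.symm, w02, w13,
      w24, w30, w41, w02.symm, w13.symm, w24.symm, w30.symm, w41.symm, d02, d03, d13, d14, d24,
      d02.symm, d03.symm, d13.symm, d14.symm, d24.symm, p0, p1, p2, p3, p4, q0, q1, q2, q3, q4,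
      p0.symm, p1.symm, p2.symm, p3.symm, p4.symm, q0.symm, q1.symm, q2.symm, q3.symm, q4.symm]
  · simp [a0, a1, a2, a3, a4, h01, h12, h23, h34, h40]
  · intro z hz
    rcases n0 z hz with rfl | rfl | rfl <;> simp
  · simp only [List.zip_cons_cons, List.zip_nil_right, List.forall_mem_cons]
    exact ⟨nb12 C n0.rot.rot m0, nb12 C n1.rot.rot m1, nb12 C n2.rot.rot m2, nb12 C n3.rot.rot m3,
      nb12 C n4.rot.rot m4, nb12 C n0.rot n1, nb12 C n1.rot n2, nb12 C n2.rot n3,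
      nb12 C n3.rot n4, nb12 C n4.rot n0, by simp⟩
  · simp only [esb, List.forall_mem_append, opt_all, decide_eq_true_eq]
    refine ⟨?_, ?_, ?_, ?_, ?_, ?_⟩
    · simp [es0, sees_mk, h01, h12, h23, h34, h40, h01.symm, h12.symm, h23.symm, h34.symm,
        h40.symm]
    all_goals exact fun h => h
  · simp only [non5, List.forall_mem_append, opt_all, Bool.not_eq_true', decide_eq_false_iff_not]
    refine ⟨?_, ?_, ?_, ?_, ?_, ?_⟩
    · simpa using ⟨o3, o4, o0, o1, o2⟩
    · exact fun h => h
    · exact fun h => h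
    · exact fun h => h
    · exact fun h h' => h (sees_symm h')
    · exact fun h h' => h (sees_symm h')

end graph4

end FC


/-- A minimal counterexample (with lists of size at least 10) has no 5-cycle. -/
theorem minimal_counterexample_no_five_cycle
    {V β : Type*} [Fintype V] (G : SimpleGraph V) [DecidableRel G.Adj]
    (hΔ : G.maxDegree ≤ 3) (L : Sym2 V → Finset β)
    (hL : ∀ e ∈ G.edgeSet, 10 ≤ (L e).card)
    (hG : ¬ StronglyListColorable G L)
    (hmin : ∀ H : SimpleGraph V, H ≤ G → H ≠ G → StronglyListColorable H L) :
    ¬ ∃ (v : V) (c : G.Walk v v), c.IsCycle ∧ c.length = 5 := by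
  rintro ⟨v, c, hc, hl⟩
  have C : FC.Ctx G L := ⟨fun v => (G.degree_le_maxDegree v).trans hΔ, hL, hG, hmin⟩
  have hinj := hc.getVert_injOn'
  have hadj : ∀ i, i < 5 → G.Adj (c.getVert i) (c.getVert (i + 1)) := fun i hi =>
    c.adj_getVert_succ (by omega)
  have h5 : c.getVert 5 = c.getVert 0 := by
    rw [← hl, c.getVert_length, c.getVert_zero]
  have hne : ∀ i j, i < 5 → j < 5 → i ≠ j → c.getVert i ≠ c.getVert j := by
    intro i j hi hj hij h
    exact hij (hinj (show i ≤ c.length - 1 by omega) (show j ≤ c.length - 1 by omega) h)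
  have h4 := hadj 4 (by omega)
  rw [h5] at h4
  exact FC.no_five C (hadj 0 (by omega)) (hadj 1 (by omega)) (hadj 2 (by omega)) (hadj 3 (by omega))
    h4 (hne 0 2 (by omega) (by omega) (by omega)) (hne 0 3 (by omega) (by omega) (by omega))
    (hne 1 3 (by omega) (by omega) (by omega)) (hne 1 4 (by omega) (by omega) (by omega))
    (hne 2 4 (by omega) (by omega) (by omega))
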